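/- Let ψ be a stopping rule with R(ψ) < ∞. Then R_N(ψ) → R(ψ) as N → ∞ if and only if ∫ t_N^ψ l_N dμᴺ → 0 as N → ∞. -/

import Mathlib

open MeasureTheory ENNReal Filter ProbabilityTheory

namespace SDP

variable {Θ X D : Type*} [MeasurableSpace Θ] [MeasurableSpace X] [MeasurableSpace D]

/-- The product measure `μⁿ` on `Xⁿ`. -/
noncomputable def pm (μ : Measure X) (n : ℕ) : Measure (Fin n → X) :=
  Measure.pi fun _ => μ

/-- `t_n^ψ = (1-ψ₁)⋯(1-ψ_{n-1})`, with `t₁^ψ ≡ 1`. -/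
noncomputable def t (ψ : ∀ n, (Fin n → X) → ℝ≥0∞) : ∀ n, (Fin n → X) → ℝ≥0∞
  | 0, _ => 1
  | 1, _ => 1
  | n + 2, x => t ψ (n + 1) (Fin.init x) * (1 - ψ (n + 1) (Fin.init x))

/-- `s_n^ψ = (1-ψ₁)⋯(1-ψ_{n-1})ψ_n`. -/
noncomputable def s (ψ : ∀ n, (Fin n → X) → ℝ≥0∞) (n : ℕ) (x : Fin n → X) : ℝ≥0∞ :=
  t ψ n x * ψ n x

/-- A stopping rule: a sequence of measurable functions with values in `[0,1]`. -/
def IsStoppingRule (ψ : ∀ n, (Fin n → X) → ℝ≥0∞) : Prop :=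
  (∀ n, Measurable (ψ n)) ∧ ∀ n x, ψ n x ≤ 1

/-- A decision rule: a sequence of measurable functions with values in `D`. -/
def IsDecisionRule (δ : ∀ n, (Fin n → X) → D) : Prop := ∀ n, Measurable (δ n)

/-- `ψ` is truncated at `N`: `ψ_n ≡ 1` for all `n ≥ N`. -/
def TruncatedAt (ψ : ∀ n, (Fin n → X) → ℝ≥0∞) (N : ℕ) : Prop :=
  ∀ n, N ≤ n → ∀ x, ψ n x = 1

/-- A consistent family of joint probability densities `f_θⁿ` w.r.t. `μⁿ`. -/
def IsDensityFamily (μ : Measure X) (f : Θ → ∀ n, (Fin n → X) → ℝ≥0∞) : Prop :=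
  (∀ n, Measurable fun p : Θ × (Fin n → X) => f p.1 n p.2) ∧
  (∀ θ x, f θ 0 x = 1) ∧
  (∀ θ n, ∫⁻ x, f θ n x ∂pm μ n = 1) ∧
  ∀ θ n (x : Fin n → X), ∫⁻ y, f θ (n + 1) (Fin.snoc x y) ∂μ = f θ n x

/-- The average loss `W(ψ,δ)`. -/
noncomputable def W (π₁ : Measure Θ) (μ : Measure X) (w : Θ → D → ℝ≥0∞)
    (f : Θ → ∀ n, (Fin n → X) → ℝ≥0∞) (ψ : ∀ n, (Fin n → X) → ℝ≥0∞)
    (δ : ∀ n, (Fin n → X) → D) : ℝ≥0∞ :=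
  ∑' n : ℕ, ∫⁻ θ, ∫⁻ x, s ψ (n + 1) x * w θ (δ (n + 1) x) * f θ (n + 1) x ∂pm μ (n + 1) ∂π₁

/-- The partial average loss `W_i(ψ,δ)` (integration over `Θᵢ`). -/
noncomputable def Wi (π₁ : Measure Θ) (μ : Measure X) (w : Θ → D → ℝ≥0∞)
    (f : Θ → ∀ n, (Fin n → X) → ℝ≥0∞) (Θi : Set Θ) (ψ : ∀ n, (Fin n → X) → ℝ≥0∞)
    (δ : ∀ n, (Fin n → X) → D) : ℝ≥0∞ :=
  ∑' n : ℕ,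
    ∫⁻ θ in Θi, ∫⁻ x, s ψ (n + 1) x * w θ (δ (n + 1) x) * f θ (n + 1) x ∂pm μ (n + 1) ∂π₁

/-- `P^{π}(τ_ψ = n)`. -/
noncomputable def PtauEq (π₂ : Measure Θ) (μ : Measure X)
    (f : Θ → ∀ n, (Fin n → X) → ℝ≥0∞) (ψ : ∀ n, (Fin n → X) → ℝ≥0∞) (n : ℕ) : ℝ≥0∞ :=
  ∫⁻ θ, ∫⁻ x, s ψ n x * f θ n x ∂pm μ n ∂π₂

/-- `P^{π}(τ_ψ < ∞)`. -/
noncomputable def Pfin (π₂ : Measure Θ) (μ : Measure X)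
    (f : Θ → ∀ n, (Fin n → X) → ℝ≥0∞) (ψ : ∀ n, (Fin n → X) → ℝ≥0∞) : ℝ≥0∞ :=
  ∑' n : ℕ, PtauEq π₂ μ f ψ (n + 1)

/-- The average sample number `N(ψ)` (equal to `∞` if `P^{π₂}(τ_ψ < ∞) < 1`). -/
noncomputable def ASN (π₂ : Measure Θ) (μ : Measure X)
    (f : Θ → ∀ n, (Fin n → X) → ℝ≥0∞) (ψ : ∀ n, (Fin n → X) → ℝ≥0∞) : ℝ≥0∞ :=
  if Pfin π₂ μ f ψ = 1 then ∑' n : ℕ, ((n : ℝ≥0∞) + 1) * PtauEq π₂ μ f ψ (n + 1) else ⊤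

/-- `fⁿ = ∫_Θ f_θⁿ dπ₂(θ)` (in particular `f⁰ ≡ 1`). -/
noncomputable def fbar (π₂ : Measure Θ) (f : Θ → ∀ n, (Fin n → X) → ℝ≥0∞)
    (n : ℕ) (x : Fin n → X) : ℝ≥0∞ :=
  ∫⁻ θ, f θ n x ∂π₂

/-- `R(ψ) = Σₙ ∫ sₙ^ψ (c n fⁿ + lₙ) dμⁿ` if `P^{π₂}(τ_ψ<∞) = 1`, `∞` otherwise. -/
noncomputable def R (π₂ : Measure Θ) (μ : Measure X) (c : ℝ≥0∞)
    (f : Θ → ∀ n, (Fin n → X) → ℝ≥0∞) (l : ∀ n, (Fin n → X) → ℝ≥0∞)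
    (ψ : ∀ n, (Fin n → X) → ℝ≥0∞) : ℝ≥0∞ :=
  if Pfin π₂ μ f ψ = 1 then
    ∑' n : ℕ, ∫⁻ x, s ψ (n + 1) x *
      (c * ((n : ℝ≥0∞) + 1) * fbar π₂ f (n + 1) x + l (n + 1) x) ∂pm μ (n + 1)
  else ⊤

/-- `R_N(ψ)`, the risk of `ψ` truncated at `N`. -/
noncomputable def RN (π₂ : Measure Θ) (μ : Measure X) (c : ℝ≥0∞)
    (f : Θ → ∀ n, (Fin n → X) → ℝ≥0∞) (l : ∀ n, (Fin n → X) → ℝ≥0∞)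
    (N : ℕ) (ψ : ∀ n, (Fin n → X) → ℝ≥0∞) : ℝ≥0∞ :=
  (∑ n ∈ Finset.range (N - 1), ∫⁻ x, s ψ (n + 1) x *
      (c * ((n : ℝ≥0∞) + 1) * fbar π₂ f (n + 1) x + l (n + 1) x) ∂pm μ (n + 1)) +
  ∫⁻ x, t ψ N x * (c * (N : ℝ≥0∞) * fbar π₂ f N x + l N x) ∂pm μ N

/-- `Vₙᴺ`, defined backwards from `V_Nᴺ = l_N` by `Vₙᴺ = min{lₙ, Qₙᴺ}`. -/
noncomputable def V (μ : Measure X) (c : ℝ≥0∞) (fb l : ∀ n, (Fin n → X) → ℝ≥0∞)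
    (N n : ℕ) (x : Fin n → X) : ℝ≥0∞ :=
  if h : n < N then
    min (l n x) (c * fb n x + ∫⁻ y, V μ c fb l N (n + 1) (Fin.snoc x y) ∂μ)
  else l n x
termination_by N - n
decreasing_by omega

/-- `Qₙᴺ = c fⁿ + ∫ Vₙ₊₁ᴺ(⋅,y) dμ(y)`. -/
noncomputable def Q (μ : Measure X) (c : ℝ≥0∞) (fb l : ∀ n, (Fin n → X) → ℝ≥0∞)
    (N n : ℕ) (x : Fin n → X) : ℝ≥0∞ :=
  c * fb n x + ∫⁻ y, V μ c fb l N (n + 1) (Fin.snoc x y) ∂μ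

/-- `Vₙ = lim_{N→∞} Vₙᴺ` (the sequence is nonincreasing in `N`, so the limit is the inf). -/
noncomputable def Vlim (μ : Measure X) (c : ℝ≥0∞) (fb l : ∀ n, (Fin n → X) → ℝ≥0∞)
    (n : ℕ) (x : Fin n → X) : ℝ≥0∞ :=
  ⨅ N, V μ c fb l N n x

/-- `Qₙ = lim_{N→∞} Qₙᴺ = c fⁿ + ∫ Vₙ₊₁(⋅,y) dμ(y)`. -/
noncomputable def Qlim (μ : Measure X) (c : ℝ≥0∞) (fb l : ∀ n, (Fin n → X) → ℝ≥0∞)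
    (n : ℕ) (x : Fin n → X) : ℝ≥0∞ :=
  c * fb n x + ∫⁻ y, Vlim μ c fb l (n + 1) (Fin.snoc x y) ∂μ

end SDP

namespace SDP

variable {Θ X D : Type*} [MeasurableSpace Θ] [MeasurableSpace X] [MeasurableSpace D]

instance sigmaFinite_pm (μ : Measure X) [SigmaFinite μ] (n : ℕ) : SigmaFinite (pm μ n) := by
  unfold pm; infer_instance

lemma measurable_fin_init (n : ℕ) :
    Measurable (Fin.init : (Fin (n + 1) → X) → Fin n → X) :=
  measurable_pi_lambda _ fun i => measurable_pi_apply i.castSucc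

lemma measurable_fin_snoc (n : ℕ) :
    Measurable fun p : X × (Fin n → X) => (Fin.snoc p.2 p.1 : Fin (n + 1) → X) := by
  refine measurable_pi_lambda _ fun i => ?_
  induction i using Fin.lastCases with
  | last => simpa using measurable_fst
  | cast i => simpa using! (measurable_pi_apply i).comp measurable_snd

/-- Tonelli's theorem for `μⁿ⁺¹`, integrating the last coordinate first. -/
lemma lintegral_pm_succ (μ : Measure X) [SigmaFinite μ] (n : ℕ)
    {F : (Fin (n + 1) → X) → ℝ≥0∞} (hF : Measurable F) :
    ∫⁻ x, F x ∂pm μ (n + 1) = ∫⁻ x, ∫⁻ y, F (Fin.snoc x y) ∂μ ∂pm μ n := by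
  have h := (measurePreserving_piFinSuccAbove (fun _ : Fin (n + 1) => μ) (Fin.last n)).symm
  have hmp : MeasurePreserving (fun p : X × (Fin n → X) => (Fin.snoc p.2 p.1 : Fin (n + 1) → X))
      (μ.prod (pm μ n)) (pm μ (n + 1)) := by
    unfold pm
    convert h using 1
    ext p i
    simp [MeasurableEquiv.piFinSuccAbove, Fin.insertNthEquiv, Fin.insertNth_last']
  rw [← hmp.lintegral_comp hF]
  exact lintegral_prod_symm' _ (hF.comp (measurable_fin_snoc n))

lemma measurable_t {ψ : ∀ n, (Fin n → X) → ℝ≥0∞} (hψ : ∀ n, Measurable (ψ n)) :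
    ∀ n, Measurable (t ψ n)
  | 0 => by
    have : t ψ 0 = fun _ => 1 := by ext; simp [t]
    rw [this]; exact measurable_const
  | 1 => by
    have : t ψ 1 = fun _ => 1 := by ext; simp [t]
    rw [this]; exact measurable_const
  | n + 2 => by
    have : t ψ (n + 2) = fun x => t ψ (n + 1) (Fin.init x) * (1 - ψ (n + 1) (Fin.init x)) := by
      ext; simp [t]
    rw [this]
    exact ((measurable_t hψ (n + 1)).comp (measurable_fin_init _)).mul
      (measurable_const.sub ((hψ (n + 1)).comp (measurable_fin_init _)))

lemma measurable_fbar {μ : Measure X} (π : Measure Θ) [SFinite π]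
    {f : Θ → ∀ n, (Fin n → X) → ℝ≥0∞} (hf : IsDensityFamily μ f) (n : ℕ) :
    Measurable (fbar π f n) :=
  (hf.1 n).lintegral_prod_left'

lemma measurable_t_mul_fbar {μ : Measure X} (π : Measure Θ) [SFinite π]
    {f : Θ → ∀ n, (Fin n → X) → ℝ≥0∞} (hf : IsDensityFamily μ f)
    {ψ : ∀ n, (Fin n → X) → ℝ≥0∞} (hψ : ∀ n, Measurable (ψ n)) (n : ℕ) :
    Measurable fun x => t ψ n x * fbar π f n x :=
  (measurable_t hψ n).mul (measurable_fbar π hf n)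

lemma measurable_s_mul_fbar {μ : Measure X} (π : Measure Θ) [SFinite π]
    {f : Θ → ∀ n, (Fin n → X) → ℝ≥0∞} (hf : IsDensityFamily μ f)
    {ψ : ∀ n, (Fin n → X) → ℝ≥0∞} (hψ : ∀ n, Measurable (ψ n)) (n : ℕ) :
    Measurable fun x => s ψ n x * fbar π f n x :=
  ((measurable_t hψ n).mul (hψ n)).mul (measurable_fbar π hf n)

lemma lintegral_fbar_snoc {μ : Measure X} [SigmaFinite μ] (π : Measure Θ) [SFinite π]
    {f : Θ → ∀ n, (Fin n → X) → ℝ≥0∞} (hf : IsDensityFamily μ f) (n : ℕ) (x : Fin n → X) :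
    ∫⁻ y, fbar π f (n + 1) (Fin.snoc x y) ∂μ = fbar π f n x := by
  unfold fbar
  rw [lintegral_lintegral_swap]
  · simp_rw [hf.2.2.2]
  · exact ((hf.1 (n + 1)).comp (measurable_snd.prodMk
      ((measurable_fin_snoc n).comp (measurable_fst.prodMk measurable_const)))).aemeasurable

lemma lintegral_fbar {μ : Measure X} [SigmaFinite μ] (π : Measure Θ) [IsProbabilityMeasure π]
    {f : Θ → ∀ n, (Fin n → X) → ℝ≥0∞} (hf : IsDensityFamily μ f) (n : ℕ) :
    ∫⁻ x, fbar π f n x ∂pm μ n = 1 := by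
  unfold fbar
  rw [lintegral_lintegral_swap]
  · simp [hf.2.2.1]
  · exact ((hf.1 n).comp measurable_swap).aemeasurable

lemma PtauEq_eq_lintegral_fbar {μ : Measure X} [SigmaFinite μ] (π : Measure Θ) [SFinite π]
    {f : Θ → ∀ n, (Fin n → X) → ℝ≥0∞} (hf : IsDensityFamily μ f)
    {ψ : ∀ n, (Fin n → X) → ℝ≥0∞} (hψ : ∀ n, Measurable (ψ n)) (n : ℕ) :
    PtauEq π μ f ψ n = ∫⁻ x, s ψ n x * fbar π f n x ∂pm μ n := by
  have hs : Measurable (s ψ n) := (measurable_t hψ n).mul (hψ n)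
  unfold PtauEq fbar
  rw [lintegral_lintegral_swap]
  · refine lintegral_congr fun x => lintegral_const_mul _ ?_
    exact (hf.1 n).comp measurable_prodMk_right
  · exact ((hs.comp measurable_snd).mul (hf.1 n)).aemeasurable

/-- `P(τ ≥ n) = P(τ = n) + P(τ ≥ n + 1)`. -/
lemma PtauEq_add_lintegral_t {μ : Measure X} [SigmaFinite μ] (π : Measure Θ) [SFinite π]
    {f : Θ → ∀ n, (Fin n → X) → ℝ≥0∞} (hf : IsDensityFamily μ f)
    {ψ : ∀ n, (Fin n → X) → ℝ≥0∞} (hψ : IsStoppingRule ψ) (n : ℕ) :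
    PtauEq π μ f ψ (n + 1) + ∫⁻ x, t ψ (n + 2) x * fbar π f (n + 2) x ∂pm μ (n + 2) =
      ∫⁻ x, t ψ (n + 1) x * fbar π f (n + 1) x ∂pm μ (n + 1) := by
  have hnext : ∫⁻ x, t ψ (n + 2) x * fbar π f (n + 2) x ∂pm μ (n + 2) =
      ∫⁻ x, t ψ (n + 1) x * (1 - ψ (n + 1) x) * fbar π f (n + 1) x ∂pm μ (n + 1) := by
    rw [lintegral_pm_succ μ (n + 1) (measurable_t_mul_fbar π hf hψ.1 (n + 2))]
    refine lintegral_congr fun x => ?_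
    simp only [t, Fin.init_snoc]
    rw [lintegral_const_mul, lintegral_fbar_snoc π hf]
    exact (measurable_fbar π hf _).comp ((measurable_fin_snoc _).comp (measurable_id.prodMk measurable_const))
  rw [hnext, PtauEq_eq_lintegral_fbar π hf hψ.1,
    ← lintegral_add_left (measurable_s_mul_fbar π hf hψ.1 (n + 1))]
  refine lintegral_congr fun x => ?_
  simp only [s]
  rw [← add_mul, ← mul_add, add_tsub_cancel_of_le (hψ.2 _ x), mul_one]

lemma sum_PtauEq_add_lintegral_t {μ : Measure X} [SigmaFinite μ] (π : Measure Θ)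
    [IsProbabilityMeasure π] {f : Θ → ∀ n, (Fin n → X) → ℝ≥0∞} (hf : IsDensityFamily μ f)
    {ψ : ∀ n, (Fin n → X) → ℝ≥0∞} (hψ : IsStoppingRule ψ) (n : ℕ) :
    ∑ k ∈ Finset.range n, PtauEq π μ f ψ (k + 1) +
      ∫⁻ x, t ψ (n + 1) x * fbar π f (n + 1) x ∂pm μ (n + 1) = 1 := by
  induction n with
  | zero => simp [t, lintegral_fbar π hf]
  | succ n ih => rw [Finset.sum_range_succ, add_assoc, PtauEq_add_lintegral_t π hf hψ, ih]

/-- If `P(τ < ∞) = 1`, then `P(τ ≥ n + 1)` is the tail of the distribution of `τ`. -/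
lemma lintegral_t_eq_tsum {μ : Measure X} [SigmaFinite μ] (π : Measure Θ)
    [IsProbabilityMeasure π] {f : Θ → ∀ n, (Fin n → X) → ℝ≥0∞} (hf : IsDensityFamily μ f)
    {ψ : ∀ n, (Fin n → X) → ℝ≥0∞} (hψ : IsStoppingRule ψ) (hP : Pfin π μ f ψ = 1) (n : ℕ) :
    ∫⁻ x, t ψ (n + 1) x * fbar π f (n + 1) x ∂pm μ (n + 1) =
      ∑' k, PtauEq π μ f ψ (k + n + 1) := by
  have h := sum_PtauEq_add_lintegral_t π hf hψ n
  have hsplit := ENNReal.summable.sum_add_tsum_nat_add' (f := fun k => PtauEq π μ f ψ (k + 1))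
    (k := n)
  rw [← Pfin, hP, ← h] at hsplit
  refine ((ENNReal.add_right_inj ?_).1 hsplit).symm
  exact ne_top_of_le_ne_top one_ne_top (h ▸ le_self_add)

end SDP

open SDP MeasureTheory ENNReal Filter in
/-- for a stopping rule with `R(ψ) < ∞`, `R_N(ψ) → R(ψ)` iff
`∫ t_N^ψ l_N dμᴺ → 0` as `N → ∞`. -/
theorem statement_10
    {Θ X D : Type*} [MeasurableSpace Θ] [MeasurableSpace X] [MeasurableSpace D]
    (μ : Measure X) [SigmaFinite μ]
    (π₁ π₂ : Measure Θ) [IsProbabilityMeasure π₁] [IsProbabilityMeasure π₂]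
    (f : Θ → ∀ n, (Fin n → X) → ℝ≥0∞) (hf : IsDensityFamily μ f)
    (w : Θ → D → ℝ≥0∞) (hw : Measurable (Function.uncurry w))
    (δB : ∀ n, (Fin n → X) → D) (hδB : IsDecisionRule δB)
    (hBayes : ∀ n (d : D), ∀ᵐ x ∂pm μ n,
      ∫⁻ θ, w θ (δB n x) * f θ n x ∂π₁ ≤ ∫⁻ θ, w θ d * f θ n x ∂π₁)
    (l : ∀ n, (Fin n → X) → ℝ≥0∞)
    (hl : ∀ n x, l n x = ∫⁻ θ, w θ (δB n x) * f θ n x ∂π₁)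
    (hl1 : ∫⁻ x, l 1 x ∂pm μ 1 < ⊤)
    (c : ℝ≥0∞) (hc : 0 < c) (hc' : c ≠ ⊤)
    (ψ : ∀ n, (Fin n → X) → ℝ≥0∞) (hψ : IsStoppingRule ψ)
    (hfin : R π₂ μ c f l ψ < ⊤) :
    Tendsto (fun N => RN π₂ μ c f l N ψ) atTop (nhds (R π₂ μ c f l ψ)) ↔
      Tendsto (fun N => ∫⁻ x, t ψ N x * l N x ∂pm μ N) atTop (nhds 0) := by
  have hP : Pfin π₂ μ f ψ = 1 := by
    by_contra h
    simp [R, h] at hfin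
  have ht := measurable_t_mul_fbar π₂ hf hψ.1
  set u : ℕ → ℝ≥0∞ := fun n => ∫⁻ x, s ψ (n + 1) x *
    (c * ((n : ℝ≥0∞) + 1) * fbar π₂ f (n + 1) x + l (n + 1) x) ∂pm μ (n + 1) with hu
  set L : ℕ → ℝ≥0∞ := fun N => ∫⁻ x, t ψ N x * l N x ∂pm μ N with hL
  set S : ℕ → ℝ≥0∞ := fun n => ∑ k ∈ Finset.range n, u k with hS
  set A : ℕ → ℝ≥0∞ := fun n =>
    c * ((n : ℝ≥0∞) + 1) * ∫⁻ x, t ψ (n + 1) x * fbar π₂ f (n + 1) x ∂pm μ (n + 1) with hA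
  have hR : R π₂ μ c f l ψ = ∑' n, u n := by simp [R, hP, hu]
  rw [hR] at hfin ⊢
  have hRN (n : ℕ) : RN π₂ μ c f l (n + 1) ψ = S n + A n + L (n + 1) := by
    simp only [RN, hS, hA, hL, hu, Nat.add_sub_cancel, Nat.cast_add, Nat.cast_one, add_assoc]
    congr 1
    rw [← lintegral_const_mul _ (ht _),
      ← lintegral_add_left ((ht _).const_mul _)]
    refine lintegral_congr fun x => ?_
    ring
  have hpu (n : ℕ) : c * ((n : ℝ≥0∞) + 1) * PtauEq π₂ μ f ψ (n + 1) ≤ u n := by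
    rw [PtauEq_eq_lintegral_fbar π₂ hf hψ.1,
      ← lintegral_const_mul _ (measurable_s_mul_fbar π₂ hf hψ.1 _)]
    refine lintegral_mono fun x => ?_
    calc _ = s ψ (n + 1) x * (c * ((n : ℝ≥0∞) + 1) * fbar π₂ f (n + 1) x) := by ring
      _ ≤ _ := by gcongr; exact le_self_add
  have hAle (n : ℕ) : A n ≤ ∑' k, u (k + n) := by
    simp only [hA, lintegral_t_eq_tsum π₂ hf hψ hP, ← ENNReal.tsum_mul_left]
    refine ENNReal.tsum_le_tsum fun k => le_trans ?_ (hpu (k + n))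
    gcongr
    simp
  have hA0 : Tendsto A atTop (nhds 0) :=
    tendsto_of_tendsto_of_tendsto_of_le_of_le tendsto_const_nhds
      (ENNReal.tendsto_sum_nat_add u hfin.ne) (fun _ => zero_le) hAle
  have hS1 : Tendsto S atTop (nhds (∑' n, u n)) := ENNReal.tendsto_nat_tsum u
  have hSA : Tendsto (fun n => S n + A n) atTop (nhds (∑' n, u n)) := by
    simpa using hS1.add hA0
  rw [← tendsto_add_atTop_iff_nat 1, ← tendsto_add_atTop_iff_nat (f := L) 1]
  simp only [hRN]
  constructor
  · intro h
    have hsub := ENNReal.Tendsto.sub h hS1 (Or.inl hfin.ne)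
    rw [tsub_self] at hsub
    refine tendsto_of_tendsto_of_tendsto_of_le_of_le tendsto_const_nhds hsub
      (fun _ => zero_le) fun n => ?_
    have hSn : S n ≠ ⊤ := ne_top_of_le_ne_top hfin.ne (ENNReal.sum_le_tsum _)
    refine ENNReal.le_sub_of_add_le_right hSn ?_
    rw [add_right_comm, add_comm (L _)]
    exact le_self_add
  · intro h
    simpa using hSA.add h
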